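/- Let 𝒯 be a finite undirected tree, w : V(𝒯) → ℝ≥0 a weight function, m = w(𝒯), and let α ∈ (0,1). Then cent^α(𝒯,w) ≤ (1/(1−α))·OPT(𝒯,w) − (α/(1−α))·m. -/

import Mathlib

open Filter Topology

universe u

variable {V : Type u}

/-- Rooted trees with vertices labelled by elements of `V`. -/
inductive RTree (V : Type u) : Type u where
  | node : V → List (RTree V) → RTree V

namespace RTree

/-- The root of a rooted tree. -/
def root : RTree V → V
  | node r _ => r

/-- The subtrees rooted at the children of the root. -/
def children : RTree V → List (RTree V)
  | node _ ts => ts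

/-- The list of pairs `(v, path from the root to v)` over all vertices `v` of the tree. -/
def pathsFrom : RTree V → List (V × List V)
  | node r ts =>
      (r, [r]) ::
        (ts.attach.map fun t => (t.1.pathsFrom.map fun p => (p.1, r :: p.2))).flatten
  decreasing_by
    simp only [RTree.node.sizeOf_spec]
    have := List.sizeOf_lt_of_mem t.2
    omega

/-- The vertex set of a rooted tree. -/
def vertSet (T : RTree V) : Set V := {v | ∃ p ∈ T.pathsFrom, p.1 = v}

/-- `Path_T(v)`: the set of vertices on the path in `T` from the root to `v`
(including both endpoints). -/
def pathSet (T : RTree V) (v : V) : Set V := {x | ∃ p ∈ T.pathsFrom, p.1 = v ∧ x ∈ p.2}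

/-- The depth of a vertex `v` in `T`; the root has depth 1. -/
noncomputable def depth (T : RTree V) (v : V) : ℕ := (T.pathSet v).ncard

/-- All subtrees of a rooted tree (including the tree itself). -/
def allSubtrees : RTree V → List (RTree V)
  | node r ts => node r ts :: (ts.attach.map fun t => t.1.allSubtrees).flatten
  decreasing_by
    simp only [RTree.node.sizeOf_spec]
    have := List.sizeOf_lt_of_mem t.2
    omega

/-- Two rooted trees are equivalent (represent the same search tree) if they have
the same root-to-vertex paths. -/
def Equiv (T₁ T₂ : RTree V) : Prop := ∀ v, T₁.pathSet v = T₂.pathSet v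

end RTree

/-- `x` and `y` are joined by a walk of `G` staying inside `s`. -/
def ReachIn (G : SimpleGraph V) (s : Set V) (x y : V) : Prop :=
  ∃ p : G.Walk x y, ∀ v ∈ p.support, v ∈ s

/-- The connected component of `x` in the subgraph of `G` induced by `s`. -/
def compIn (G : SimpleGraph V) (s : Set V) (x : V) : Set V := {y | ReachIn G s x y}

/-- The set of connected components of the subgraph of `G` induced by `s`. -/
def comps (G : SimpleGraph V) (s : Set V) : Set (Set V) := {c | ∃ x ∈ s, c = compIn G s x}

/-- `s` induces a (nonempty) connected subgraph of `G`. -/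
def ConnIn (G : SimpleGraph V) (s : Set V) : Prop :=
  s.Nonempty ∧ ∀ x ∈ s, ∀ y ∈ s, ReachIn G s x y

/-- The total weight of a set of vertices. -/
noncomputable def wsum (w : V → ℝ) (s : Set V) : ℝ := ∑ᶠ x ∈ s, w x

/-- `IsSearchTree G s T`: `T` is a search tree on the subgraph of `G` induced by `s`.
Its root `r` is a vertex of `s`, its vertex set is `s`, and the subtrees rooted at the
children of `r` are search trees on the connected components of the induced subgraph
on `s \ {r}` (one subtree for each component). -/
inductive IsSearchTree (G : SimpleGraph V) : Set V → RTree V → Prop where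
  | node {s : Set V} {r : V} {ts : List (RTree V)} :
      r ∈ s →
      (RTree.node r ts).vertSet = s →
      (∀ t ∈ ts, IsSearchTree G (compIn G (s \ {r}) t.root) t) →
      ts.Pairwise (fun t₁ t₂ => compIn G (s \ {r}) t₁.root ≠ compIn G (s \ {r}) t₂.root) →
      IsSearchTree G s (RTree.node r ts)

/-- The cost of a search tree: `∑_x w(x) · depth(x)`, the root having depth 1. -/
noncomputable def cost (w : V → ℝ) (T : RTree V) : ℝ :=
  ∑ᶠ v ∈ T.vertSet, w v * (T.depth v : ℝ)

/-- The optimum cost of a search tree on the subgraph of `G` induced by `s`. -/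
noncomputable def OPT (G : SimpleGraph V) (w : V → ℝ) (s : Set V) : ℝ :=
  sInf (cost w '' {T | IsSearchTree G s T})

/-- `v` is an `α`-centroid of the subgraph of `G` induced by `s` (with weights `w`):
every connected component of the induced subgraph on `s \ {v}` has weight at most
`α` times the weight of `s`. -/
def IsAlphaCentroid (G : SimpleGraph V) (w : V → ℝ) (α : ℝ) (s : Set V) (v : V) : Prop :=
  v ∈ s ∧ ∀ x ∈ s \ {v}, wsum w (compIn G (s \ {v}) x) ≤ α * wsum w s

/-- `v` is a centroid of the subgraph of `G` induced by `s` (with weights `w`). -/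
def IsCentroid (G : SimpleGraph V) (w : V → ℝ) (s : Set V) (v : V) : Prop :=
  v ∈ s ∧ ∀ x ∈ s \ {v}, wsum w (compIn G (s \ {v}) x) ≤ wsum w s / 2

/-- `T` is an `α`-centroid tree on the subgraph of `G` induced by `s`. -/
def IsAlphaCentroidTree (G : SimpleGraph V) (w : V → ℝ) (α : ℝ) (s : Set V) (T : RTree V) :
    Prop :=
  IsSearchTree G s T ∧ ∀ t ∈ T.allSubtrees, IsAlphaCentroid G w α t.vertSet t.root

/-- `T` is a centroid tree on the subgraph of `G` induced by `s`. -/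
def IsCentroidTree (G : SimpleGraph V) (w : V → ℝ) (s : Set V) (T : RTree V) : Prop :=
  IsSearchTree G s T ∧ ∀ t ∈ T.allSubtrees, IsCentroid G w t.vertSet t.root

/-- `cent(𝒯,w)`: the maximum cost of a centroid tree. -/
noncomputable def centCost (G : SimpleGraph V) (w : V → ℝ) (s : Set V) : ℝ :=
  sSup (cost w '' {T | IsCentroidTree G w s T})

/-- `centᵅ(𝒯,w)`: the maximum cost of an `α`-centroid tree (`0` if none exists, since
`sSup ∅ = 0` in `ℝ`). -/
noncomputable def centCostA (G : SimpleGraph V) (w : V → ℝ) (α : ℝ) (s : Set V) : ℝ :=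
  sSup (cost w '' {T | IsAlphaCentroidTree G w α s T})

/-- `b` is a child of `a` in the rooted tree `T`. -/
def ChildRel (T : RTree V) (a b : V) : Prop :=
  ∃ t ∈ T.allSubtrees, t.root = a ∧ ∃ t' ∈ t.children, t'.root = b

namespace RTree

theorem mem_pathsFrom_node {r : V} {ts : List (RTree V)} {p : V × List V} :
    p ∈ (node r ts).pathsFrom ↔
      p = (r, [r]) ∨ ∃ t ∈ ts, ∃ q ∈ t.pathsFrom, p = (q.1, r :: q.2) := by
  rw [pathsFrom]
  simp only [List.mem_cons, List.mem_flatten, List.mem_map, List.mem_attach, true_and,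
    Subtype.exists]
  constructor
  · rintro (h | ⟨l, ⟨t, ht, rfl⟩, h⟩)
    · exact Or.inl h
    · obtain ⟨q, hq, rfl⟩ := List.mem_map.1 h
      exact Or.inr ⟨t, ht, q, hq, rfl⟩
  · rintro (h | ⟨t, ht, q, hq, rfl⟩)
    · exact Or.inl h
    · exact Or.inr ⟨_, ⟨t, ht, rfl⟩, List.mem_map.2 ⟨q, hq, rfl⟩⟩

theorem mem_vertSet_node {r : V} {ts : List (RTree V)} {v : V} :
    v ∈ (node r ts).vertSet ↔ v = r ∨ ∃ t ∈ ts, v ∈ t.vertSet := by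
  simp only [vertSet, Set.mem_ofPred_eq, mem_pathsFrom_node]
  constructor
  · rintro ⟨p, rfl | ⟨t, ht, q, hq, rfl⟩, rfl⟩
    · exact Or.inl rfl
    · exact Or.inr ⟨t, ht, q, hq, rfl⟩
  · rintro (rfl | ⟨t, ht, q, hq, rfl⟩)
    · exact ⟨_, Or.inl rfl, rfl⟩
    · exact ⟨_, Or.inr ⟨t, ht, q, hq, rfl⟩, rfl⟩

theorem mem_pathSet_node {r : V} {ts : List (RTree V)} {v x : V} :
    x ∈ (node r ts).pathSet v ↔
      (v = r ∧ x = r) ∨ ∃ t ∈ ts, v ∈ t.vertSet ∧ (x = r ∨ x ∈ t.pathSet v) := by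
  simp only [pathSet, vertSet, Set.mem_ofPred_eq, mem_pathsFrom_node]
  constructor
  · rintro ⟨p, rfl | ⟨t, ht, q, hq, rfl⟩, rfl, hx⟩
    · exact Or.inl ⟨rfl, by simpa using hx⟩
    · refine Or.inr ⟨t, ht, ⟨q, hq, rfl⟩, ?_⟩
      rcases List.mem_cons.1 hx with hx | hx
      · exact Or.inl hx
      · exact Or.inr ⟨q, hq, rfl, hx⟩
  · rintro (⟨rfl, rfl⟩ | ⟨t, ht, ⟨q, hq, rfl⟩, rfl | ⟨q', hq', h, hx⟩⟩)
    · exact ⟨_, Or.inl rfl, rfl, by simp⟩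
    · exact ⟨_, Or.inr ⟨t, ht, q, hq, rfl⟩, rfl, by simp⟩
    · exact ⟨_, Or.inr ⟨t, ht, q', hq', rfl⟩, h, by simp [hx]⟩

theorem root_mem_vertSet (T : RTree V) : T.root ∈ T.vertSet := by
  cases T
  exact mem_vertSet_node.2 (Or.inl rfl)

theorem root_mem_pathSet {r : V} {ts : List (RTree V)} {v : V}
    (hv : v ∈ (node r ts).vertSet) : r ∈ (node r ts).pathSet v := by
  rw [mem_pathSet_node]
  rcases mem_vertSet_node.1 hv with rfl | ⟨t, ht, h⟩
  · exact Or.inl ⟨rfl, rfl⟩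
  · exact Or.inr ⟨t, ht, h, Or.inl rfl⟩

theorem mem_allSubtrees_node {r : V} {ts : List (RTree V)} {u : RTree V} :
    u ∈ (node r ts).allSubtrees ↔ u = node r ts ∨ ∃ t ∈ ts, u ∈ t.allSubtrees := by
  rw [allSubtrees]
  simp only [List.mem_cons, List.mem_flatten, List.mem_map, List.mem_attach, true_and,
    Subtype.exists]
  constructor
  · rintro (h | ⟨l, ⟨t, ht, rfl⟩, h⟩)
    · exact Or.inl h
    · exact Or.inr ⟨t, ht, h⟩
  · rintro (h | ⟨t, ht, h⟩)
    · exact Or.inl h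
    · exact Or.inr ⟨_, ⟨t, ht, rfl⟩, h⟩

end RTree

section Reachability

variable {G : SimpleGraph V} {s : Set V} {x y z : V}

theorem ReachIn.refl (hx : x ∈ s) : ReachIn G s x x :=
  ⟨.nil, by simpa using hx⟩

theorem ReachIn.symm (h : ReachIn G s x y) : ReachIn G s y x := by
  obtain ⟨p, hp⟩ := h
  exact ⟨p.reverse, by simpa using hp⟩

theorem ReachIn.trans (h : ReachIn G s x y) (h' : ReachIn G s y z) : ReachIn G s x z := by
  obtain ⟨p, hp⟩ := h
  obtain ⟨q, hq⟩ := h'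
  refine ⟨p.append q, fun v hv => ?_⟩
  rcases (SimpleGraph.Walk.mem_support_append_iff p q).1 hv with h | h
  · exact hp v h
  · exact hq v h

theorem ReachIn.mono {t : Set V} (hst : s ⊆ t) (h : ReachIn G s x y) : ReachIn G t x y := by
  obtain ⟨p, hp⟩ := h
  exact ⟨p, fun v hv => hst (hp v hv)⟩

theorem ReachIn.left_mem (h : ReachIn G s x y) : x ∈ s := by
  obtain ⟨p, hp⟩ := h
  exact hp x p.start_mem_support

theorem compIn_subset : compIn G s x ⊆ s := fun _ h => ReachIn.left_mem (ReachIn.symm h)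

theorem compIn_eq_of_mem (h : y ∈ compIn G s x) : compIn G s y = compIn G s x :=
  Set.ext fun _ => ⟨fun hz => ReachIn.trans h hz, fun hz => (ReachIn.symm h).trans hz⟩

theorem compIn_eq_empty (hx : x ∉ s) : compIn G s x = ∅ :=
  Set.eq_empty_of_forall_notMem fun _ h => hx (ReachIn.left_mem h)

theorem ReachIn.in_compIn (h : ReachIn G s x y) : ReachIn G (compIn G s x) x y := by
  classical
  obtain ⟨p, hp⟩ := h
  exact ⟨p, fun v hv => ⟨p.takeUntil v hv, fun u hu =>
    hp u (p.support_takeUntil_subset_support hv hu)⟩⟩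

theorem connIn_compIn (hx : x ∈ s) : ConnIn G (compIn G s x) :=
  ⟨⟨x, ReachIn.refl hx⟩, fun _ hy _ hz => (ReachIn.in_compIn hy).symm.trans (ReachIn.in_compIn hz)⟩

theorem connIn_singleton : ConnIn G {x} := by
  refine ⟨⟨x, rfl⟩, ?_⟩
  rintro _ rfl _ rfl
  exact ReachIn.refl rfl

end Reachability

section SearchTree

variable {G : SimpleGraph V} {s : Set V} {r : V} {ts : List (RTree V)}

theorem IsSearchTree.vertSet_eq {T : RTree V} (h : IsSearchTree G s T) : T.vertSet = s := by
  cases h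
  assumption

theorem IsSearchTree.of_mem (h : IsSearchTree G s (.node r ts)) {t : RTree V} (ht : t ∈ ts) :
    IsSearchTree G (compIn G (s \ {r}) t.root) t := by
  cases h with
  | node _ _ h _ => exact h t ht

theorem IsSearchTree.vertSet_child (h : IsSearchTree G s (.node r ts)) {t : RTree V}
    (ht : t ∈ ts) : t.vertSet = compIn G (s \ {r}) t.root :=
  (h.of_mem ht).vertSet_eq

theorem IsSearchTree.vertSet_child_subset (h : IsSearchTree G s (.node r ts)) {t : RTree V}
    (ht : t ∈ ts) : t.vertSet ⊆ s \ {r} := by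
  rw [h.vertSet_child ht]
  exact compIn_subset

theorem IsSearchTree.vertSet_child_eq (h : IsSearchTree G s (.node r ts)) {t : RTree V}
    (ht : t ∈ ts) {v : V} (hv : v ∈ t.vertSet) : t.vertSet = compIn G (s \ {r}) v := by
  rw [h.vertSet_child ht] at hv ⊢
  exact (compIn_eq_of_mem hv).symm

theorem IsSearchTree.pairwise_disjoint (h : IsSearchTree G s (.node r ts)) :
    ts.Pairwise fun t₁ t₂ => Disjoint t₁.vertSet t₂.vertSet := by
  have hp : ts.Pairwise fun t₁ t₂ =>
      compIn G (s \ {r}) t₁.root ≠ compIn G (s \ {r}) t₂.root := by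
    cases h
    assumption
  refine hp.imp_of_mem fun {t₁ t₂} h₁ h₂ hne => ?_
  rw [Set.disjoint_left]
  intro v hv₁ hv₂
  apply hne
  rw [← h.vertSet_child h₁, ← h.vertSet_child h₂, h.vertSet_child_eq h₁ hv₁,
    h.vertSet_child_eq h₂ hv₂]

theorem IsSearchTree.pathSet_child (h : IsSearchTree G s (.node r ts)) {t : RTree V}
    (ht : t ∈ ts) {v : V} (hv : v ∈ t.vertSet) :
    (RTree.node r ts).pathSet v = insert r (t.pathSet v) := by
  ext x
  rw [RTree.mem_pathSet_node, Set.mem_insert_iff]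
  constructor
  · rintro (⟨-, rfl⟩ | ⟨t', ht', hv', hx⟩)
    · exact Or.inl rfl
    · have : t' = t := by
        by_contra hne
        have : Std.Symm fun t₁ t₂ : RTree V => Disjoint t₁.vertSet t₂.vertSet :=
          ⟨fun _ _ hd => Disjoint.symm hd⟩
        exact Set.disjoint_left.1 (h.pairwise_disjoint.forall ht' ht hne) hv' hv
      exact this ▸ hx
  · exact fun hx => Or.inr ⟨t, ht, hv, hx⟩

/-- A connected vertex set contains a vertex lying on all root paths to the set. -/
theorem IsSearchTree.exists_common_ancestor {T : RTree V} (hT : IsSearchTree G s T) {h : Set V}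
    (hs : h ⊆ s) (hc : ConnIn G h) : ∃ r ∈ h, ∀ v ∈ h, r ∈ T.pathSet v := by
  induction hT with
  | @node s r ts hr hv hts hp ih =>
    by_cases hrh : r ∈ h
    · exact ⟨r, hrh, fun v hvh => RTree.root_mem_pathSet (hv ▸ hs hvh)⟩
    · have hT := IsSearchTree.node hr hv hts hp
      obtain ⟨v₀, hv₀⟩ := hc.1
      have hmem : v₀ ∈ (RTree.node r ts).vertSet := hv ▸ hs hv₀
      rcases RTree.mem_vertSet_node.1 hmem with rfl | ⟨t, ht, hvt⟩
      · exact absurd hv₀ hrh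
      · have hsub : h ⊆ t.vertSet := by
          rw [hT.vertSet_child_eq ht hvt]
          exact fun x hx => (hc.2 v₀ hv₀ x hx).mono fun y hy =>
            ⟨hs hy, fun hyr => hrh (Set.mem_singleton_iff.1 hyr ▸ hy)⟩
        obtain ⟨a, ha, hav⟩ := ih t ht (hT.vertSet_child ht ▸ hsub)
        refine ⟨a, ha, fun v hvh => ?_⟩
        rw [hT.pathSet_child ht (hsub hvh)]
        exact Or.inr (hav v hvh)

theorem IsSearchTree.mem_pathSet {T : RTree V} (hT : IsSearchTree G s T) {v : V} (hv : v ∈ s) :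
    v ∈ T.pathSet v := by
  obtain ⟨r, rfl, h⟩ :=
    hT.exists_common_ancestor (Set.singleton_subset_iff.2 hv) connIn_singleton
  exact h r rfl

theorem exists_isSearchTree [Finite V] (G : SimpleGraph V) (s : Set V) (hs : s.Nonempty) :
    ∃ T, IsSearchTree G s T := by
  induction hn : s.ncard using Nat.strong_induction_on generalizing s with
  | _ n ih =>
    obtain ⟨r, hr⟩ := hs
    have hex : ∀ c : Set V, ∃ T, c ∈ comps G (s \ {r}) → IsSearchTree G c T := by
      intro c
      by_cases hc : c ∈ comps G (s \ {r})
      · obtain ⟨x, hx, rfl⟩ := hc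
        have hlt : (compIn G (s \ {r}) x).ncard < s.ncard :=
          (Set.ncard_le_ncard compIn_subset).trans_lt (Set.ncard_sdiff_singleton_lt_of_mem hr)
        obtain ⟨T, hT⟩ := ih _ (hn ▸ hlt) _ ⟨x, ReachIn.refl hx⟩ rfl
        exact ⟨T, fun _ => hT⟩
      · exact ⟨.node r [], fun h => absurd h hc⟩
    choose F hF using hex
    have hroot : ∀ c ∈ comps G (s \ {r}), compIn G (s \ {r}) (F c).root = c := by
      intro c hc
      have hmem : (F c).root ∈ c :=
        (hF c hc).vertSet_eq.subset (F c).root_mem_vertSet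
      obtain ⟨x, hx, rfl⟩ := hc
      exact compIn_eq_of_mem hmem
    have hfin : (comps G (s \ {r})).Finite := Set.toFinite _
    have hl : ∀ c, c ∈ hfin.toFinset.toList ↔ c ∈ comps G (s \ {r}) := by simp
    refine ⟨.node r (hfin.toFinset.toList.map F), .node hr ?_ ?_ ?_⟩
    · ext v
      rw [RTree.mem_vertSet_node]
      constructor
      · rintro (rfl | ⟨t, ht, hv⟩)
        · exact hr
        · obtain ⟨c, hc, rfl⟩ := List.mem_map.1 ht
          rw [hl] at hc
          rw [(hF c hc).vertSet_eq] at hv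
          obtain ⟨x, hx, rfl⟩ := hc
          exact (compIn_subset hv).1
      · intro hv
        by_cases hvr : v = r
        · exact Or.inl hvr
        · have hv' : v ∈ s \ {r} := ⟨hv, hvr⟩
          have hc : compIn G (s \ {r}) v ∈ comps G (s \ {r}) := ⟨v, hv', rfl⟩
          refine Or.inr ⟨_, List.mem_map_of_mem ((hl _).2 hc), ?_⟩
          rw [(hF _ hc).vertSet_eq]
          exact ReachIn.refl hv'
    · intro t ht
      obtain ⟨c, hc, rfl⟩ := List.mem_map.1 ht
      rw [hl] at hc
      rw [hroot c hc]
      exact hF c hc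
    · rw [List.pairwise_map]
      refine (Finset.nodup_toList _).imp_of_mem fun hc hd hne => ?_
      rw [hl] at hc hd
      rwa [hroot _ hc, hroot _ hd]

theorem IsAlphaCentroidTree.of_mem {w : V → ℝ} {α : ℝ}
    (h : IsAlphaCentroidTree G w α s (.node r ts)) {t : RTree V} (ht : t ∈ ts) :
    IsAlphaCentroidTree G w α (compIn G (s \ {r}) t.root) t :=
  ⟨h.1.of_mem ht, fun u hu => h.2 u (RTree.mem_allSubtrees_node.2 (Or.inr ⟨t, ht, hu⟩))⟩

end SearchTree

section Sums

variable [Finite V]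

theorem finsum_mem_le_finsum_mem_of_le {s : Set V} {f g : V → ℝ} (h : ∀ v ∈ s, f v ≤ g v) :
    ∑ᶠ v ∈ s, f v ≤ ∑ᶠ v ∈ s, g v := by
  have := s.toFinite.fintype
  simp only [finsum_mem_eq_toFinset_sum]
  exact Finset.sum_le_sum fun v hv => h v (Set.mem_toFinset.1 hv)

theorem finsum_mem_vertSet_list (f : V → ℝ) {ts : List (RTree V)}
    (h : ts.Pairwise fun t₁ t₂ => Disjoint t₁.vertSet t₂.vertSet) :
    ∑ᶠ v ∈ {v | ∃ t ∈ ts, v ∈ t.vertSet}, f v =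
      (ts.map fun t => ∑ᶠ v ∈ t.vertSet, f v).sum := by
  induction ts with
  | nil => simp
  | cons t ts ih =>
    rw [List.pairwise_cons] at h
    have hset : {v | ∃ u ∈ t :: ts, v ∈ u.vertSet} =
        t.vertSet ∪ {v | ∃ u ∈ ts, v ∈ u.vertSet} := by
      ext v
      simp
    rw [hset, finsum_mem_union ?_ (Set.toFinite _) (Set.toFinite _), ih h.2, List.map_cons,
      List.sum_cons]
    rw [Set.disjoint_left]
    rintro v hv ⟨u, hu, hvu⟩
    exact Set.disjoint_left.1 (h.1 u hu) hv hvu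

theorem IsSearchTree.finsum_mem_eq {G : SimpleGraph V} {s : Set V} {r : V} {ts : List (RTree V)}
    (h : IsSearchTree G s (.node r ts)) (f : V → ℝ) :
    ∑ᶠ v ∈ s, f v = f r + (ts.map fun t => ∑ᶠ v ∈ t.vertSet, f v).sum := by
  have hset : s = insert r {v | ∃ t ∈ ts, v ∈ t.vertSet} := by
    rw [← h.vertSet_eq]
    ext v
    exact RTree.mem_vertSet_node
  rw [hset, finsum_mem_insert f ?_ (Set.toFinite _),
    finsum_mem_vertSet_list f h.pairwise_disjoint]
  rintro ⟨t, ht, hr⟩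
  exact (h.vertSet_child_subset ht hr).2 rfl

theorem IsSearchTree.cost_le {G : SimpleGraph V} {s : Set V} {r : V} {ts : List (RTree V)}
    {w : V → ℝ} (hw : ∀ x, 0 ≤ w x) (h : IsSearchTree G s (.node r ts)) :
    cost w (.node r ts) ≤ wsum w s + (ts.map (cost w)).sum := by
  have hroot : (RTree.node r ts).depth r = 1 := by
    have : (RTree.node r ts).pathSet r = {r} := by
      ext x
      rw [RTree.mem_pathSet_node, Set.mem_singleton_iff]
      constructor
      · rintro (h' | ⟨t, ht, hr, -⟩)
        · exact h'.2
        · exact absurd rfl (h.vertSet_child_subset ht hr).2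
      · exact fun hx => Or.inl ⟨rfl, hx⟩
    rw [RTree.depth, this, Set.ncard_singleton]
  rw [cost, h.vertSet_eq, wsum, h.finsum_mem_eq, h.finsum_mem_eq w, hroot, add_assoc,
    ← List.sum_map_add, Nat.cast_one, mul_one]
  refine add_le_add_right (List.sum_le_sum fun t ht => ?_) _
  rw [cost, ← finsum_mem_add_distrib (Set.toFinite _)]
  refine finsum_mem_le_finsum_mem_of_le fun v hv => ?_
  have hd : (RTree.node r ts).depth v ≤ t.depth v + 1 := by
    rw [RTree.depth, h.pathSet_child ht hv]
    exact Set.ncard_insert_le _ _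
  have hd' : ((RTree.node r ts).depth v : ℝ) ≤ t.depth v + 1 := by exact_mod_cast hd
  nlinarith [mul_le_mul_of_nonneg_left hd' (hw v)]

end Sums

/-- The cost bound for an `α`-centroid tree on a connected set `h`, relative to any assignment `P`
of ancestor sets such that every connected set has a common ancestor inside itself. -/
theorem IsAlphaCentroidTree.cost_bound [Finite V] {G : SimpleGraph V} {w : V → ℝ}
    (hw : ∀ x, 0 ≤ w x) {α : ℝ} (hα0 : 0 ≤ α) (hα1 : α ≤ 1) {P : V → Set V}
    (hP : ∀ v, v ∈ P v) (hPc : ∀ h, ConnIn G h → ∃ r ∈ h, ∀ v ∈ h, r ∈ P v)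
    {h : Set V} (hh : ConnIn G h) {C : RTree V} (hC : IsAlphaCentroidTree G w α h C) :
    (1 - α) * cost w C + α * wsum w h ≤ ∑ᶠ v ∈ h, w v * ((P v ∩ h).ncard : ℝ) := by
  have hS := hC.1
  induction hS with
  | @node h c ts hc hvs hts hp ih =>
    have hS := hC.1
    obtain ⟨r, hrh, hr⟩ := hPc h hh
    set K := compIn G (h \ {c}) r with hK
    have hW0 : ∀ s : Set V, 0 ≤ wsum w s := fun s =>
      finsum_nonneg fun x => finsum_nonneg fun _ => hw x
    have hKle : wsum w K ≤ α * wsum w h := by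
      by_cases hrc : r = c
      · have hK0 : K = ∅ := compIn_eq_empty (by simp [hrc])
        rw [hK0, wsum, finsum_mem_empty]
        exact mul_nonneg hα0 (hW0 h)
      · have := (hC.2 _ (RTree.mem_allSubtrees_node.2 (Or.inl rfl))).2
        rw [hvs] at this
        exact this r ⟨hrh, hrc⟩
    have hKsum : wsum w K = (ts.map fun t => ∑ᶠ v ∈ t.vertSet, K.indicator w v).sum := by
      have hcK : c ∉ K := fun hcK => (compIn_subset hcK).2 rfl
      have h1 := hS.finsum_mem_eq (K.indicator w)
      rw [Set.indicator_of_notMem hcK, zero_add] at h1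
      have hKh : K ⊆ h := fun x hx => (compIn_subset hx).1
      rw [← h1, wsum, finsum_mem_def, finsum_mem_def, Set.indicator_indicator,
        Set.inter_eq_self_of_subset_right hKh]
    have hchild : ∀ t ∈ ts,
        (1 - α) * cost w t + (α * wsum w t.vertSet + wsum w t.vertSet) ≤
          ∑ᶠ v ∈ t.vertSet, w v * ((P v ∩ h).ncard : ℝ) +
            ∑ᶠ v ∈ t.vertSet, K.indicator w v := by
      intro t ht
      have hrt : t.root ∈ h \ {c} := hS.vertSet_child_subset ht t.root_mem_vertSet
      have hI := ih t ht (connIn_compIn hrt) (hC.of_mem ht)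
      rw [← hS.vertSet_child ht] at hI
      rw [← finsum_mem_add_distrib (Set.toFinite _)]
      rw [← add_assoc]
      refine (add_le_add_left hI _).trans ?_
      rw [wsum, ← finsum_mem_add_distrib (Set.toFinite _)]
      refine finsum_mem_le_finsum_mem_of_le fun v hv => ?_
      have hth : t.vertSet ⊆ h := fun x hx => (hS.vertSet_child_subset ht hx).1
      by_cases hvK : v ∈ K
      · rw [Set.indicator_of_mem hvK]
        have hle : (P v ∩ t.vertSet).ncard ≤ (P v ∩ h).ncard :=
          Set.ncard_le_ncard (Set.inter_subset_inter_right _ hth)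
        have hle' : ((P v ∩ t.vertSet).ncard : ℝ) ≤ (P v ∩ h).ncard := by exact_mod_cast hle
        exact add_le_add_left (mul_le_mul_of_nonneg_left hle' (hw v)) _
      · rw [Set.indicator_of_notMem hvK, add_zero]
        have hlt : (P v ∩ t.vertSet).ncard < (P v ∩ h).ncard := by
          refine Set.ncard_lt_ncard ((Set.ssubset_iff_of_subset
            (Set.inter_subset_inter_right _ hth)).2 ⟨r, ⟨hr v (hth hv), hrh⟩, fun hrt => hvK ?_⟩)
          rw [hK, ← hS.vertSet_child_eq ht hrt.2]
          exact hv
        have hle' : ((P v ∩ t.vertSet).ncard : ℝ) + 1 ≤ (P v ∩ h).ncard := by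
          exact_mod_cast hlt
        nlinarith [mul_le_mul_of_nonneg_left hle' (hw v)]
    have hsum := List.sum_le_sum hchild
    simp only [List.sum_map_add, List.sum_map_mul_left] at hsum
    rw [← hKsum] at hsum
    have hcost := mul_le_mul_of_nonneg_left (hS.cost_le hw) (sub_nonneg.2 hα1)
    have hWh : wsum w h = w c + (ts.map fun t => wsum w t.vertSet).sum := hS.finsum_mem_eq w
    rw [hS.finsum_mem_eq]
    set A := (ts.map fun t => wsum w t.vertSet).sum
    have hA : 0 ≤ A := List.sum_nonneg (by
      intro a ha
      obtain ⟨t, -, rfl⟩ := List.mem_map.1 ha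
      exact hW0 _)
    have hwc := hw c
    by_cases hrc : r = c
    · have hK0 : wsum w K = 0 := by
        rw [hK, compIn_eq_empty (by simp [hrc]), wsum, finsum_mem_empty]
      have h1 : 1 ≤ (P c ∩ h).ncard := (Set.ncard_pos).2 ⟨c, hP c, hc⟩
      have h1' : (1 : ℝ) ≤ (P c ∩ h).ncard := by exact_mod_cast h1
      have h2 := mul_le_mul_of_nonneg_left h1' hwc
      rw [hWh] at hcost ⊢
      rw [hK0] at hsum
      nlinarith [mul_nonneg hα0 hA]
    · have h1 : 2 ≤ (P c ∩ h).ncard := by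
        rw [← Set.ncard_pair hrc]
        refine Set.ncard_le_ncard ?_
        rintro x (rfl | rfl)
        · exact ⟨hr c hc, hrh⟩
        · exact ⟨hP _, hc⟩
      have h1' : (2 : ℝ) ≤ (P c ∩ h).ncard := by exact_mod_cast h1
      have h2 := mul_le_mul_of_nonneg_left h1' hwc
      rw [hWh] at hcost hKle ⊢
      nlinarith [mul_nonneg hα0 hA, mul_nonneg (sub_nonneg.2 hα1) hwc]

theorem alpha_centroid_tree_approx {V : Type} [Fintype V]
    (G : SimpleGraph V) (hG : G.IsTree) (w : V → ℝ) (hw : ∀ x, 0 ≤ w x)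
    (α : ℝ) (hα0 : 0 < α) (hα1 : α < 1) :
    centCostA G w α Set.univ ≤
      (1 / (1 - α)) * OPT G w Set.univ - (α / (1 - α)) * wsum w Set.univ := by
  have hne : Nonempty V := hG.1.nonempty
  have hconn : ConnIn G Set.univ := by
    refine ⟨Set.univ_nonempty, fun x _ y _ => ?_⟩
    obtain ⟨p⟩ := hG.1.preconnected x y
    exact ⟨p, fun v _ => Set.mem_univ v⟩
  have hα : 0 < 1 - α := sub_pos.2 hα1
  have hOPT : ∀ b, (∀ T, IsSearchTree G Set.univ T → b ≤ cost w T) → b ≤ OPT G w Set.univ := by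
    intro b hb
    obtain ⟨T, hT⟩ := exists_isSearchTree G Set.univ Set.univ_nonempty
    refine le_csInf ⟨_, T, hT, rfl⟩ ?_
    rintro _ ⟨T, hT, rfl⟩
    exact hb T hT
  have hrw : (1 / (1 - α)) * OPT G w Set.univ - (α / (1 - α)) * wsum w Set.univ =
      (OPT G w Set.univ - α * wsum w Set.univ) / (1 - α) := by ring
  rw [hrw, centCostA]
  refine Real.sSup_le ?_ (div_nonneg (sub_nonneg.2 (hOPT _ fun T hT => ?_)) hα.le)
  · rintro _ ⟨C, hC, rfl⟩
    rw [le_div_iff₀ hα, le_sub_iff_add_le]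
    refine hOPT _ fun T hT => ?_
    have h := hC.cost_bound hw hα0.le hα1.le (P := T.pathSet)
      (fun v => hT.mem_pathSet (Set.mem_univ v))
      (fun h hh => hT.exists_common_ancestor (Set.subset_univ h) hh) hconn
    simp only [Set.inter_univ] at h
    rw [mul_comm (cost w C), cost.eq_def w T, hT.vertSet_eq]
    exact h
  · have h0 : 0 ≤ wsum w Set.univ := finsum_nonneg fun x => finsum_nonneg fun _ => hw x
    refine (mul_le_of_le_one_left h0 hα1.le).trans ?_
    rw [cost, hT.vertSet_eq]
    refine finsum_mem_le_finsum_mem_of_le fun v hv => le_mul_of_one_le_right (hw v) ?_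
    have : 1 ≤ T.depth v := (Set.ncard_pos).2 ⟨v, hT.mem_pathSet hv⟩
    exact_mod_cast this
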